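/- Let d ≥ 1, β > 0, ŷ ∈ ℝ^d, let p = p(ŷ, β) be the SquareCB.Hilbert action distribution, and let Σ := E_{a∼p}[a aᵀ]. Then for every f* in the closed unit ball B_d ⊂ ℝ^d, sup_{a*∈B_d} E_{a∼p}[⟨f*, a⟩ − ⟨f*, a*⟩] ≤ 9β + (4d/β) ⟨ŷ − f*, Σ(ŷ − f*)⟩. -/

import Mathlib

open Finset Matrix RealInnerProductSpace

/-- Expectation of `φ` under the SquareCB.Hilbert action distribution `p(ŷ, β)`
with parameters `α` and `ỹ`: probability `1 − α` on `−ỹ` and probability `α/(2d)`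
on each of the `2d` points `±e_i`. -/
noncomputable def hilbertExp {d : ℕ} {E : Type*} [AddCommMonoid E] [Module ℝ E]
    (α : ℝ) (ytil : EuclideanSpace ℝ (Fin d)) (φ : EuclideanSpace ℝ (Fin d) → E) : E :=
  (1 - α) • φ (-ytil) +
    ∑ i : Fin d, ((α / (2 * d)) • φ (EuclideanSpace.single i 1) +
      (α / (2 * d)) • φ (-EuclideanSpace.single i 1))

/-- The second-moment matrix `Σ = E_{a∼p}[a aᵀ]` of the SquareCB.Hilbert
distribution. -/
noncomputable def hilbertSecondMoment {d : ℕ} (α : ℝ) (ytil : EuclideanSpace ℝ (Fin d)) :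
    Matrix (Fin d) (Fin d) ℝ :=
  hilbertExp α ytil (fun a => Matrix.vecMulVec (fun i => a i) (fun i => a i))


set_option maxHeartbeats 2000000 in
theorem hilbert_scalar (β D W N s t r α : ℝ) (hβ : 0 < β) (hD : 1 ≤ D) (hW : t ^ 2 ≤ W)
    (hN : 0 ≤ N) (hNs : N ^ 2 = s ^ 2 + W - t ^ 2) (hr : 0 ≤ r) (ht : t = r - s)
    (hα : (α = 1 / 2 ∧ r ≤ 2 * β) ∨ (α * r = β ∧ 2 * β < r)) :
    N - (1 - α) * s ≤ 9 * β + 4 * D / β * ((1 - α) * t ^ 2 + α / D * W) := by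
  have hD0 : 0 < D := by linarith
  have e : 4 * D / β * ((1 - α) * t ^ 2 + α / D * W)
      = 4 * (1 - α) * (D * (t ^ 2 / β)) + 4 * (α / β) * W := by
    field_simp
  rw [e]
  have hT0 : 0 ≤ t ^ 2 / β := by positivity
  have hDT : t ^ 2 / β ≤ D * (t ^ 2 / β) := by nlinarith
  have hsN : |s| ≤ N := abs_le_of_sq_le_sq (by nlinarith) hN
  have hs1 := neg_abs_le s
  have hs2 := le_abs_self s
  rcases hα with ⟨rfl, hrb⟩ | ⟨hαr, hrb⟩
  · have h1 : (N - r) ^ 2 ≤ W := by subst ht; nlinarith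
    have h2 : 3 / 2 * N ≤ 9 * β + 2 * W / β := by
      rw [← sub_le_iff_le_add', le_div_iff₀ hβ]
      nlinarith [sq_nonneg (N - r - β)]
    have h3 : 4 * (1 / 2 / β) * W = 2 * W / β := by ring
    rw [h3]
    linarith
  · have hr0 : 0 < r := by linarith
    have hα' : α = β / r := by field_simp; linarith
    have hα0 : 0 < α := by rw [hα']; positivity
    have hα2 : α ≤ 1 / 2 := by rw [hα', div_le_iff₀ hr0]; linarith
    have h3 : 4 * (α / β) * W = 4 * W / r := by rw [hα']; field_simp
    rw [h3]
    have ht1 := neg_abs_le t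
    have ht2 := le_abs_self t
    have ht0 := abs_nonneg t
    have hA : α * s ≤ β + |t| / 2 := by
      have : α * s = β - α * t := by rw [ht]; linarith
      nlinarith
    have hB : N - s ≤ 4 * W / r + 3 * |t| := by
      rcases le_or_gt (r / 2) s with h | h
      · have : N - s ≤ 4 * W / r := by
          rw [le_div_iff₀ hr0]
          have h5 : (N - s) * (N + s) ≤ W := by nlinarith
          have h6 : s ≤ N := by linarith
          have h7 : (N - s) * r ≤ (N - s) * (N + s) :=
            mul_le_mul_of_nonneg_left (by linarith) (by linarith)
          nlinarith
        linarith
      · have h8 : N ≤ 4 * W / r + r / 16 + |s| := by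
          have hw0 : 0 ≤ W - t ^ 2 := by linarith
          have hw := Real.sq_sqrt hw0
          have hwn := Real.sqrt_nonneg (W - t ^ 2)
          set w := Real.sqrt (W - t ^ 2)
          have h9 : N ≤ |s| + w := by
            refine (sq_le_sq₀ hN (by positivity)).mp ?_
            nlinarith [sq_abs s, mul_nonneg (abs_nonneg s) hwn]
          have h10 : w - r / 16 ≤ 4 * W / r := by
            rw [le_div_iff₀ hr0]
            nlinarith [sq_nonneg (2 * w - r / 4)]
          linarith
        have : |s| - s ≤ 2 * t := by
          rcases abs_cases s with ⟨h, _⟩ | ⟨h, _⟩ <;> rw [h] <;> linarith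
        linarith
    have hC : 7 / 2 * |t| ≤ 8 * β + 2 * (t ^ 2 / β) := by
      have : 7 / 2 * |t| - 8 * β ≤ 2 * t ^ 2 / β := by
        rw [le_div_iff₀ hβ]
        nlinarith [sq_nonneg (|t| - 2 * β), sq_abs t]
      rw [mul_div_assoc] at this
      linarith
    have hE : 2 * (D * (t ^ 2 / β)) ≤ 4 * (1 - α) * (D * (t ^ 2 / β)) :=
      mul_le_mul_of_nonneg_right (by linarith) (by positivity)
    linarith

theorem hilbert_loss {d : ℕ} (hd : 1 ≤ d) (α : ℝ) (u f a : EuclideanSpace ℝ (Fin d)) :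
    hilbertExp α u (fun x => ⟪f, x⟫ - ⟪f, a⟫) = -(1 - α) * ⟪f, u⟫ - ⟪f, a⟫ := by
  have hd' : (d : ℝ) ≠ 0 := by positivity
  have : ∀ i : Fin d, (α / (2 * d)) • (⟪f, EuclideanSpace.single i (1 : ℝ)⟫ - ⟪f, a⟫) +
      (α / (2 * d)) • (⟪f, -EuclideanSpace.single i (1 : ℝ)⟫ - ⟪f, a⟫) = -(α / d) * ⟪f, a⟫ := by
    intro i
    rw [inner_neg_right, smul_eq_mul, smul_eq_mul]
    field_simp
    ring
  unfold hilbertExp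
  rw [Finset.sum_congr rfl (fun i _ => this i)]
  simp only [Finset.sum_const, Finset.card_univ, Fintype.card_fin,
    inner_neg_right, smul_eq_mul, nsmul_eq_mul]
  field_simp
  ring

theorem hilbert_quad {d : ℕ} (hd : 1 ≤ d) (α : ℝ) (u δ : EuclideanSpace ℝ (Fin d)) :
    ((fun i => δ i) ⬝ᵥ (hilbertSecondMoment α u).mulVec (fun i => δ i))
      = (1 - α) * ⟪u, δ⟫ ^ 2 + α / d * ‖δ‖ ^ 2 := by
  have hd' : (d : ℝ) ≠ 0 := by positivity
  have key : ∀ a : EuclideanSpace ℝ (Fin d), ((fun i => δ i) ⬝ᵥ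
      (Matrix.vecMulVec (fun i => a i) (fun i => a i)).mulVec (fun i => δ i)) = ⟪a, δ⟫ ^ 2 := by
    intro a
    have h1 : ⟪a, δ⟫ = (fun i => a i) ⬝ᵥ (fun i => δ i) := by
      simp [PiLp.inner_apply, dotProduct, mul_comm]
    rw [Matrix.vecMulVec_mulVec, h1, sq]
    simp [dotProduct_comm]
  simp only [hilbertSecondMoment, hilbertExp, Matrix.add_mulVec, Matrix.sum_mulVec,
    Matrix.smul_mulVec, dotProduct_add, dotProduct_sum, dotProduct_smul, key, inner_neg_left,
    neg_sq, smul_eq_mul]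
  rw [EuclideanSpace.real_norm_sq_eq, Finset.mul_sum]
  congr 1
  apply Finset.sum_congr rfl
  intro i _
  rw [EuclideanSpace.inner_single_left]
  simp
  field_simp
  ring

/-- per-round bound for SquareCB.Hilbert, combining both cases:
for every `β > 0`, every `ŷ ∈ ℝ^d`, and every `f*` in the closed unit ball, the
SquareCB.Hilbert distribution `p = p(ŷ, β)` (with `α = min(β/‖ŷ‖, 1/2)`, `α = 1/2`
and `ỹ` an arbitrary unit vector when `ŷ = 0`) satisfies
`sup_{a*∈B_d} E_{a∼p}[⟨f*,a⟩ − ⟨f*,a*⟩] ≤ 9β + (4d/β)⟨ŷ − f*, Σ(ŷ − f*)⟩`. -/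
theorem hilbert_per_step_bound (d : ℕ) (hd : 1 ≤ d) (β : ℝ) (hβ : 0 < β)
    (yhat : EuclideanSpace ℝ (Fin d))
    (α : ℝ) (ytil : EuclideanSpace ℝ (Fin d))
    (hα : (yhat ≠ 0 → α = min (β / ‖yhat‖) (1 / 2)) ∧ (yhat = 0 → α = 1 / 2))
    (hytil : (yhat ≠ 0 → ytil = ‖yhat‖⁻¹ • yhat) ∧ (yhat = 0 → ‖ytil‖ = 1))
    (fstar : EuclideanSpace ℝ (Fin d)) (hf : ‖fstar‖ ≤ 1) :
    (⨆ astar : (Metric.closedBall (0 : EuclideanSpace ℝ (Fin d)) 1),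
        hilbertExp α ytil (fun a => ⟪fstar, a⟫ - ⟪fstar, (astar : EuclideanSpace ℝ (Fin d))⟫))
      ≤ 9 * β + (4 * d / β) *
          ((fun i => yhat i - fstar i) ⬝ᵥ
            (hilbertSecondMoment α ytil).mulVec (fun i => yhat i - fstar i)) := by
  have hdr : (1 : ℝ) ≤ d := by exact_mod_cast hd
  have hu : ‖ytil‖ = 1 := by
    by_cases h : yhat = 0
    · exact hytil.2 h
    · rw [hytil.1 h, norm_smul, norm_inv, norm_norm]
      exact inv_mul_cancel₀ (norm_ne_zero_iff.mpr h)
  have hy : yhat = ‖yhat‖ • ytil := by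
    by_cases h : yhat = 0
    · simp [h]
    · rw [hytil.1 h, smul_smul, mul_inv_cancel₀ (norm_ne_zero_iff.mpr h), one_smul]
  have hα' : (α = 1 / 2 ∧ ‖yhat‖ ≤ 2 * β) ∨ (α * ‖yhat‖ = β ∧ 2 * β < ‖yhat‖) := by
    by_cases h : yhat = 0
    · left
      refine ⟨hα.2 h, ?_⟩
      rw [h, norm_zero]
      positivity
    · have hp : 0 < ‖yhat‖ := norm_pos_iff.mpr h
      rcases le_or_gt ‖yhat‖ (2 * β) with h1 | h1
      · left
        refine ⟨?_, h1⟩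
        rw [hα.1 h, min_eq_right]
        rw [le_div_iff₀ hp]
        linarith
      · right
        refine ⟨?_, h1⟩
        rw [hα.1 h, min_eq_left, div_mul_cancel₀ _ hp.ne']
        rw [div_le_iff₀ hp]
        linarith
  have hq := hilbert_quad hd α ytil (yhat - fstar)
  simp only [PiLp.sub_apply] at hq
  rw [hq]
  have huu : ⟪ytil, ytil⟫ = 1 := by rw [real_inner_self_eq_norm_sq, hu]; norm_num
  have ht : ⟪ytil, yhat - fstar⟫ = ‖yhat‖ - ⟪fstar, ytil⟫ := by
    rw [inner_sub_right, real_inner_comm ytil fstar]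
    nth_rewrite 1 [hy]
    rw [inner_smul_right, huu, mul_one]
  have hW : ⟪ytil, yhat - fstar⟫ ^ 2 ≤ ‖yhat - fstar‖ ^ 2 := by
    have h := abs_real_inner_le_norm ytil (yhat - fstar)
    rw [hu, one_mul] at h
    rw [← sq_abs]
    exact pow_le_pow_left₀ (abs_nonneg _) h 2
  have hyf : ⟪yhat, fstar⟫ = ‖yhat‖ * ⟪fstar, ytil⟫ := by
    nth_rewrite 1 [hy]
    rw [real_inner_smul_left, real_inner_comm]
  have hN : ‖fstar‖ ^ 2 = ⟪fstar, ytil⟫ ^ 2 + ‖yhat - fstar‖ ^ 2 - ⟪ytil, yhat - fstar⟫ ^ 2 := by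
    rw [ht, norm_sub_sq_real, hyf]
    ring
  have main := hilbert_scalar β d _ _ _ _ _ α hβ hdr hW (norm_nonneg _) hN (norm_nonneg _) ht hα'
  haveI : Nonempty (Metric.closedBall (0 : EuclideanSpace ℝ (Fin d)) 1) := ⟨⟨0, by simp⟩⟩
  apply ciSup_le
  intro a
  rw [hilbert_loss hd]
  have ha : ‖(a : EuclideanSpace ℝ (Fin d))‖ ≤ 1 := mem_closedBall_zero_iff.mp a.2
  have h1 := neg_le_of_abs_le (abs_real_inner_le_norm fstar (a : EuclideanSpace ℝ (Fin d)))
  have h2 : ‖fstar‖ * ‖(a : EuclideanSpace ℝ (Fin d))‖ ≤ ‖fstar‖ :=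
    mul_le_of_le_one_right (norm_nonneg _) ha
  linarith
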